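/- Let ε, ν ∈ {1,−1} and let θ ∈ ℝ with sin θ ≠ 0. Set R := ε R_ν(θ) and E := I₈ + ε (2i sin θ)^{−1}(R − R^{−1}), so that the skein identity R − R^{−1} = −ε · 2i sin θ · (I₈ − E) holds by construction. Then E² = 2E; i.e., all four operators ±R_ν(θ) satisfy a Kauffman-type skein relation with factor ∓2i sin θ for both values of ν. -/

import Mathlib

open Matrix

/-- The generalized Yang-Baxter operator `R_ν(θ)` on `(ℂ²)^{⊗3}`, given in the
lexicographically ordered basis `e_{(i₁,i₂,i₃)}` by the block-diagonal matrix `diag(A,B)`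
with `A = [[νC,0,iS,0],[0,−iS,0,C],[iS,0,νC,0],[0,C,0,−iS]]` (acting on `i₁ = 0`) and
`B = [[−iS,0,C,0],[0,νC,0,iS],[C,0,−iS,0],[0,iS,0,νC]]` (acting on `i₁ = 1`),
where `C = cos θ`, `S = sin θ`.  Equivalently: the entry at `((i₁,i₂,i₃),(j₁,j₂,j₃))`
vanishes unless `i₁ = j₁` and `i₃ = j₃`, and in the `i₂,j₂` indices it is the 2×2 block
`[[νC,iS],[iS,νC]]` if `i₁ = i₃`, and `[[−iS,C],[C,−iS]]` if `i₁ ≠ i₃`. -/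
noncomputable def gYB (ν : ℂ) (θ : ℝ) :
    Matrix (Fin 2 × Fin 2 × Fin 2) (Fin 2 × Fin 2 × Fin 2) ℂ :=
  Matrix.of fun p q =>
    if p.1 = q.1 ∧ p.2.2 = q.2.2 then
      if p.1 = p.2.2 then
        if p.2.1 = q.2.1 then ν * (Real.cos θ : ℂ) else Complex.I * (Real.sin θ : ℂ)
      else
        if p.2.1 = q.2.1 then -(Complex.I * (Real.sin θ : ℂ)) else (Real.cos θ : ℂ)
    else 0

/-- `R_ν(θ)` and `R_ν(-θ)` are mutually inverse. -/
theorem gYB_mul_gYB_neg {ν : ℂ} (hν : ν * ν = 1) (θ : ℝ) : gYB ν θ * gYB ν (-θ) = 1 := by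
  have h : (Complex.cos θ) ^ 2 + (Complex.sin θ) ^ 2 = 1 := Complex.cos_sq_add_sin_sq _
  have hI : Complex.I * Complex.I = -1 := Complex.I_mul_I
  ext ⟨a, b, c⟩ ⟨a', b', c'⟩
  fin_cases a <;> fin_cases b <;> fin_cases c <;> fin_cases a' <;> fin_cases b' <;>
    fin_cases c' <;>
    simp [gYB, Matrix.mul_apply, Fintype.sum_prod_type, Fin.sum_univ_two] <;>
    grind

/-- The involution flipping the middle tensor factor on the span of the basis vectors with
`i₁ = i₃` and acting as `-1` on the span of those with `i₁ ≠ i₃`. It equals `R_ν(π / 2)`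
up to the factor `i`. -/
noncomputable def gYBFlip : Matrix (Fin 2 × Fin 2 × Fin 2) (Fin 2 × Fin 2 × Fin 2) ℂ :=
  Matrix.of fun p q =>
    if p.1 = q.1 ∧ p.2.2 = q.2.2 then
      if p.1 = p.2.2 then
        if p.2.1 = q.2.1 then 0 else 1
      else
        if p.2.1 = q.2.1 then -1 else 0
    else 0

theorem gYBFlip_mul_self : gYBFlip * gYBFlip = 1 := by
  ext ⟨a, b, c⟩ ⟨a', b', c'⟩
  fin_cases a <;> fin_cases b <;> fin_cases c <;> fin_cases a' <;> fin_cases b' <;>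
    fin_cases c' <;>
    simp [gYBFlip, Matrix.mul_apply, Fintype.sum_prod_type, Fin.sum_univ_two]

theorem gYB_sub_gYB_neg (ν : ℂ) (θ : ℝ) :
    gYB ν θ - gYB ν (-θ) = (2 * Complex.I * (Real.sin θ : ℂ)) • gYBFlip := by
  ext p q
  simp only [gYB, gYBFlip, Matrix.sub_apply, Matrix.smul_apply, Matrix.of_apply, Real.cos_neg,
    Real.sin_neg, Complex.ofReal_neg, smul_eq_mul]
  split_ifs <;> ring

/-- for `ε, ν ∈ {1,−1}` and `θ ∈ ℝ` with `sin θ ≠ 0`, setting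
`R := ε R_ν(θ)` and `E := I₈ + ε (2i sin θ)⁻¹ (R − R⁻¹)` (so that the skein identity
`R − R⁻¹ = −ε · 2i sin θ · (I₈ − E)` holds by construction), one has `E² = 2E`:
all four operators `±R_ν(θ)` satisfy a Kauffman-type skein relation with factor
`∓2i sin θ`. -/
theorem stmt_12 (ε ν : ℂ) (hε : ε = 1 ∨ ε = -1) (hν : ν = 1 ∨ ν = -1)
    (θ : ℝ) (hθ : Real.sin θ ≠ 0)
    (R E : Matrix (Fin 2 × Fin 2 × Fin 2) (Fin 2 × Fin 2 × Fin 2) ℂ)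
    (hR : R = ε • gYB ν θ)
    (hE : E = 1 + ε • ((2 * Complex.I * (Real.sin θ : ℂ))⁻¹ • (R - R⁻¹))) :
    E * E = (2 : ℂ) • E := by
  have hεε : ε * ε = 1 := by rcases hε with rfl | rfl <;> norm_num
  have hνν : ν * ν = 1 := by rcases hν with rfl | rfl <;> norm_num
  have hs : 2 * Complex.I * (Real.sin θ : ℂ) ≠ 0 := by
    simpa [← Complex.ofReal_sin] using hθ
  have h_inv : R⁻¹ = ε • gYB ν (-θ) := by
    refine Matrix.inv_eq_right_inv ?_
    rw [hR, smul_mul_smul_comm, hεε, one_smul, gYB_mul_gYB_neg hνν]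
  have h_flip : E = 1 + gYBFlip := by
    rw [hE, h_inv, hR, ← smul_sub, gYB_sub_gYB_neg, smul_comm _ ε, inv_smul_smul₀ hs, smul_smul,
      hεε, one_smul]
  rw [h_flip, mul_add, add_mul, add_mul, gYBFlip_mul_self, two_smul]
  simp only [mul_one, one_mul]
  abel
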